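/- Let d ≥ 1, suppose H satisfies assumptions (A.1) and (A.2), and assume lim_{s→∞} ν̲(s) = +∞. Let ζ ∈ C¹([0,∞)), let L ≥ 0, and let u₀ : ℝ^d → ℝ be bounded and Lipschitz with Lipschitz constant at most L. Suppose u : ℝ^d × [0,∞) → ℝ is continuous, bounded on ℝ^d × [0,T] for every T > 0, satisfies u(·,0) = u₀, and is a viscosity solution of u_t = H(Du,x)·ζ'(t) on ℝ^d × (0,∞). Then for every t ≥ 0, |u(x,t) − u(y,t)| ≤ ν̲^{-1}(ν̄(L))·|x−y| for all x,y ∈ ℝ^d, where ν̲^{-1}(m) := sup{ s ≥ 0 : ν̲(s) ≤ m }. -/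

import Mathlib

open Set MeasureTheory
open scoped Topology
noncomputable section

/-- Assumption (A.1): `H(p,x)` is continuous, convex in `p`, and squeezed
between `ν̲(|p|)` and `ν̄(|p|)` for convex nondecreasing `ν̲, ν̄ : [0,∞) → ℝ`. -/
def AssumptionA1 (d : ℕ)
    (H : EuclideanSpace ℝ (Fin d) → EuclideanSpace ℝ (Fin d) → ℝ)
    (νlo νhi : ℝ → ℝ) : Prop :=
  Continuous (fun q : EuclideanSpace ℝ (Fin d) × EuclideanSpace ℝ (Fin d) => H q.1 q.2) ∧
  (∀ x, ConvexOn ℝ univ (fun p => H p x)) ∧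
  ConvexOn ℝ (Ici (0 : ℝ)) νlo ∧ ConvexOn ℝ (Ici (0 : ℝ)) νhi ∧
  MonotoneOn νlo (Ici (0 : ℝ)) ∧ MonotoneOn νhi (Ici (0 : ℝ)) ∧
  (∀ p x, νlo ‖p‖ ≤ H p x ∧ H p x ≤ νhi ‖p‖)

/-- Assumption (A.2): for every `R > 0`, `H` is `C²` with bounded second
derivatives on `B_R × ℝ^d`, and the Hessian of `H` in the `p`-variable is
positive definite everywhere. -/
def AssumptionA2 (d : ℕ)
    (H : EuclideanSpace ℝ (Fin d) → EuclideanSpace ℝ (Fin d) → ℝ) : Prop :=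
  (∀ R > (0 : ℝ),
    ContDiffOn ℝ 2 (fun q : EuclideanSpace ℝ (Fin d) × EuclideanSpace ℝ (Fin d) => H q.1 q.2)
      (Metric.ball 0 R ×ˢ univ) ∧
    ∃ M : ℝ, ∀ q ∈ (Metric.ball (0 : EuclideanSpace ℝ (Fin d)) R ×ˢ
        (univ : Set (EuclideanSpace ℝ (Fin d)))),
      ‖iteratedFDerivWithin ℝ 2
          (fun q : EuclideanSpace ℝ (Fin d) × EuclideanSpace ℝ (Fin d) => H q.1 q.2)
          (Metric.ball 0 R ×ˢ univ) q‖ ≤ M) ∧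
  (∀ p x v, v ≠ 0 →
    0 < fderiv ℝ (fun p' => fderiv ℝ (fun p'' => H p'' x) p') p v v)

/-- Viscosity subsolution of `u_t = H(Du,x)·g(t)` on `ℝ^d × (0,∞)`:
at every interior local maximum of `u − φ` on `ℝ^d × (0,∞)`, for `φ` a `C¹` test
function, `∂_t φ ≤ H(D_x φ, x₀)·g(t₀)`. -/
def ViscositySubsolution (d : ℕ)
    (H : EuclideanSpace ℝ (Fin d) → EuclideanSpace ℝ (Fin d) → ℝ)
    (g : ℝ → ℝ) (u : EuclideanSpace ℝ (Fin d) → ℝ → ℝ) : Prop :=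
  ∀ φ : EuclideanSpace ℝ (Fin d) × ℝ → ℝ, ContDiff ℝ 1 φ →
    ∀ (x₀ : EuclideanSpace ℝ (Fin d)) (t₀ : ℝ), 0 < t₀ →
      IsLocalMaxOn (fun q : EuclideanSpace ℝ (Fin d) × ℝ => u q.1 q.2 - φ q)
        {q : EuclideanSpace ℝ (Fin d) × ℝ | 0 < q.2} (x₀, t₀) →
      deriv (fun t => φ (x₀, t)) t₀ ≤
        H (gradient (fun x => φ (x, t₀)) x₀) x₀ * g t₀

/-- Viscosity supersolution of `u_t = H(Du,x)·g(t)` on `ℝ^d × (0,∞)`. -/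
def ViscositySupersolution (d : ℕ)
    (H : EuclideanSpace ℝ (Fin d) → EuclideanSpace ℝ (Fin d) → ℝ)
    (g : ℝ → ℝ) (u : EuclideanSpace ℝ (Fin d) → ℝ → ℝ) : Prop :=
  ∀ φ : EuclideanSpace ℝ (Fin d) × ℝ → ℝ, ContDiff ℝ 1 φ →
    ∀ (x₀ : EuclideanSpace ℝ (Fin d)) (t₀ : ℝ), 0 < t₀ →
      IsLocalMinOn (fun q : EuclideanSpace ℝ (Fin d) × ℝ => u q.1 q.2 - φ q)
        {q : EuclideanSpace ℝ (Fin d) × ℝ | 0 < q.2} (x₀, t₀) →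
      H (gradient (fun x => φ (x, t₀)) x₀) x₀ * g t₀ ≤
        deriv (fun t => φ (x₀, t)) t₀

def ViscositySolution (d : ℕ)
    (H : EuclideanSpace ℝ (Fin d) → EuclideanSpace ℝ (Fin d) → ℝ)
    (g : ℝ → ℝ) (u : EuclideanSpace ℝ (Fin d) → ℝ → ℝ) : Prop :=
  ViscositySubsolution d H g u ∧ ViscositySupersolution d H g u


section metric
variable {E : Type*} [NormedAddCommGroup E] [InnerProductSpace ℝ E]

/-- functions which are subsolutions of `H(Dv,x) ≤ m` (integrated form) -/
def Adm (H : E → E → ℝ) (m : ℝ) (v : E → ℝ) : Prop :=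
  ∀ x x' c, (∀ z ∈ segment ℝ x x', ∀ a, H a z ≤ m → inner ℝ a (x' - x) ≤ c) → v x' - v x ≤ c

/-- the maximal subsolution metric -/
def dm (H : E → E → ℝ) (m : ℝ) (x y : E) : ℝ :=
  sSup {r | ∃ v, Adm H m v ∧ r = v x - v y}

lemma adm_zero {H : E → E → ℝ} {m : ℝ} (h0 : ∀ z, H 0 z ≤ m) : Adm H m (fun _ => 0) := by
  intro x x' c h
  simpa using h x (left_mem_segment ℝ x x') 0 (h0 x)

lemma adm_le {H : E → E → ℝ} {m K : ℝ} (hK : ∀ a z, H a z ≤ m → ‖a‖ ≤ K) {v : E → ℝ}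
    (hv : Adm H m v) (x y : E) : v x - v y ≤ K * ‖x - y‖ := by
  refine hv y x _ fun z _ a ha => ?_
  exact (real_inner_le_norm _ _).trans (mul_le_mul_of_nonneg_right (hK a z ha) (norm_nonneg _))

lemma le_dm {H : E → E → ℝ} {m K : ℝ} (hK : ∀ a z, H a z ≤ m → ‖a‖ ≤ K) {v : E → ℝ}
    (hv : Adm H m v) (x y : E) : v x - v y ≤ dm H m x y := by
  refine le_csSup ⟨K * ‖x - y‖, ?_⟩ ⟨v, hv, rfl⟩
  rintro r ⟨w, hw, rfl⟩
  exact adm_le hK hw x y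

lemma dm_le {H : E → E → ℝ} {m r : ℝ} (h0 : ∀ z, H 0 z ≤ m) {x y : E}
    (h : ∀ v, Adm H m v → v x - v y ≤ r) : dm H m x y ≤ r := by
  refine csSup_le ⟨_, _, adm_zero h0, rfl⟩ ?_
  rintro r ⟨w, hw, rfl⟩
  exact h w hw

lemma dm_adm {H : E → E → ℝ} {m K : ℝ} (hK : ∀ a z, H a z ≤ m → ‖a‖ ≤ K)
    (h0 : ∀ z, H 0 z ≤ m) (y : E) : Adm H m (fun z => dm H m z y) := by
  intro x x' c h
  have : dm H m x' y ≤ c + dm H m x y := by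
    refine dm_le h0 fun v hv => ?_
    have h1 := hv x x' c h
    have h2 := le_dm hK hv x y
    linarith
  simp only
  linarith

lemma dm_nonneg {H : E → E → ℝ} {m K : ℝ} (hK : ∀ a z, H a z ≤ m → ‖a‖ ≤ K)
    (h0 : ∀ z, H 0 z ≤ m) (x y : E) : 0 ≤ dm H m x y := by
  simpa using le_dm hK (adm_zero h0) x y

lemma dm_self {H : E → E → ℝ} {m K : ℝ} (hK : ∀ a z, H a z ≤ m → ‖a‖ ≤ K)
    (h0 : ∀ z, H 0 z ≤ m) (x : E) : dm H m x x = 0 := by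
  refine le_antisymm (dm_le h0 fun v _ => by simp) (dm_nonneg hK h0 x x)

lemma dm_le_norm {H : E → E → ℝ} {m K : ℝ} (hK : ∀ a z, H a z ≤ m → ‖a‖ ≤ K)
    (h0 : ∀ z, H 0 z ≤ m) (x y : E) : dm H m x y ≤ K * ‖x - y‖ :=
  dm_le h0 fun _ hv => adm_le hK hv x y

lemma dm_tri {H : E → E → ℝ} {m K : ℝ} (hK : ∀ a z, H a z ≤ m → ‖a‖ ≤ K)
    (h0 : ∀ z, H 0 z ≤ m) (x y z : E) : dm H m x z ≤ dm H m x y + dm H m y z := by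
  refine dm_le h0 fun v hv => ?_
  have h1 := le_dm hK hv x y
  have h2 := le_dm hK hv y z
  linarith

lemma adm_neg {H : E → E → ℝ} {m : ℝ} {v : E → ℝ} (hv : Adm H m v) :
    Adm (fun a z => H (-a) z) m (fun x => - v x) := by
  intro x x' c h
  have := hv x' x c fun z hz a ha => by
    have := h z (by rwa [segment_symm]) (-a) (by simpa using ha)
    rw [inner_neg_left, ← inner_neg_right, neg_sub] at this
    exact this
  linarith

lemma dm_symm (H : E → E → ℝ) (m : ℝ) (x y : E) :
    dm (fun a z => H (-a) z) m y x = dm H m x y := by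
  unfold dm
  congr 1
  ext r
  constructor
  · rintro ⟨v, hv, rfl⟩
    refine ⟨fun x => - v x, ?_, by ring⟩
    have := adm_neg hv
    simpa using this
  · rintro ⟨v, hv, rfl⟩
    exact ⟨_, adm_neg hv, by ring⟩

lemma dm_continuous {H : E → E → ℝ} {m K : ℝ} (hK : ∀ a z, H a z ≤ m → ‖a‖ ≤ K)
    (h0 : ∀ z, H 0 z ≤ m) : Continuous (fun q : E × E => dm H m q.1 q.2) := by
  have key : ∀ q q' : E × E, dm H m q.1 q.2 - dm H m q'.1 q'.2 ≤
      K * (‖q.1 - q'.1‖ + ‖q.2 - q'.2‖) := by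
    intro q q'
    have h1 := dm_tri hK h0 q.1 q'.1 q.2
    have h2 := dm_tri hK h0 q'.1 q'.2 q.2
    have h3 := dm_le_norm hK h0 q.1 q'.1
    have h4 := dm_le_norm hK h0 q'.2 q.2
    rw [norm_sub_rev] at h4
    linarith
  rw [continuous_iff_continuousAt]
  intro q'
  have hlim : Filter.Tendsto (fun q : E × E => K * (‖q.1 - q'.1‖ + ‖q.2 - q'.2‖)) (𝓝 q') (𝓝 0) := by
    have : Continuous (fun q : E × E => K * (‖q.1 - q'.1‖ + ‖q.2 - q'.2‖)) := by fun_prop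
    simpa using this.tendsto q'
  rw [ContinuousAt, tendsto_iff_dist_tendsto_zero]
  refine squeeze_zero (fun _ => dist_nonneg) (fun q => ?_) hlim
  rw [Real.dist_eq, abs_le]
  have h1 := key q q'
  have h2 := key q' q
  rw [norm_sub_rev q'.1, norm_sub_rev q'.2] at h2
  constructor <;> linarith

lemma adm_of_lip {H : E → E → ℝ} {m L : ℝ} (hL0 : 0 ≤ L) (hL : ∀ a z, ‖a‖ ≤ L → H a z ≤ m)
    {v : E → ℝ} (hv : ∀ x y, v x - v y ≤ L * ‖x - y‖) : Adm H m v := by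
  intro x x' c h
  refine (hv x' x).trans ?_
  rcases eq_or_ne x' x with rfl | hne
  · have := h x' (left_mem_segment ℝ _ _) 0 (hL _ _ (by simpa using hL0))
    simpa using this
  · have hn : ‖x' - x‖ ≠ 0 := norm_ne_zero_iff.2 (sub_ne_zero.2 hne)
    have := h x (left_mem_segment ℝ _ _) ((L / ‖x' - x‖) • (x' - x)) (hL _ _ (by
      rw [norm_smul, Real.norm_eq_abs, abs_of_nonneg (by positivity)]
      field_simp; rfl))
    rw [real_inner_smul_left, real_inner_self_eq_norm_sq] at this
    have e : L * ‖x' - x‖ = L / ‖x' - x‖ * ‖x' - x‖ ^ 2 := by field_simp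
    rw [e]
    exact this

/-- subsolution property at subdifferentials (uses convexity) -/
lemma dm_sub [FiniteDimensional ℝ E] {H : E → E → ℝ} {m K : ℝ}
    (hH : Continuous (fun q : E × E => H q.1 q.2))
    (hconv : ∀ x, ConvexOn ℝ univ (fun p => H p x))
    (hK : ∀ a z, H a z ≤ m → ‖a‖ ≤ K) (h0 : ∀ z, H 0 z ≤ m) {x y p : E} {C : ℝ}
    (hp : ∀ z, dm H m x y + inner ℝ p (z - x) - C * ‖z - x‖ ^ 2 ≤ dm H m z y) : H p x ≤ m := by
  by_contra hcon
  have hHx : Continuous (fun a => H a x) := hH.comp (by fun_prop : Continuous fun a : E => (a, x))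
  have hconvA : Convex ℝ {a | H a x ≤ m} := by
    have := (hconv x).convex_le m
    simpa using this
  have hclosed : IsClosed {a | H a x ≤ m} := isClosed_le hHx continuous_const
  obtain ⟨f, c, hfA, hfp⟩ := geometric_hahn_banach_closed_point hconvA hclosed (x := p) hcon
  obtain ⟨e, he⟩ : ∃ e : E, ∀ a, f a = inner ℝ a e := by
    refine ⟨(InnerProductSpace.toDual ℝ E).symm f, fun a => ?_⟩
    rw [real_inner_comm, InnerProductSpace.toDual_symm_apply]
  simp only [he] at hfA hfp
  have hev : ∀ᶠ z in 𝓝 x, ∀ a ∈ Metric.closedBall (0 : E) K ∩ {a | c ≤ inner ℝ a e}, m < H a z := by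
    have hcomp : IsCompact (Metric.closedBall (0 : E) K ∩ {a | c ≤ inner ℝ a e}) :=
      (isCompact_closedBall 0 K).inter_right (isClosed_le (by fun_prop) (by fun_prop))
    refine hcomp.eventually_forall_of_forall_eventually ?_
    intro a ha
    have : m < H a x := by
      by_contra h
      have := hfA a (not_lt.1 h)
      exact absurd ha.2 (not_le.2 this)
    have hc : Continuous (fun q : E × E => H q.2 q.1) := hH.comp (by fun_prop : Continuous fun q : E × E => (q.2, q.1))
    exact hc.continuousAt.eventually_const_lt this
  obtain ⟨r, hr, hball⟩ := Metric.eventually_nhds_iff_ball.1 hev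
  have hstep : ∀ t : ℝ, 0 < t → t * ‖e‖ < r → t * inner ℝ p e - C * (t * ‖e‖) ^ 2 ≤ t * c := by
    intro t ht htr
    have h1 := hp (x + t • e)
    have h2 := dm_adm hK h0 y x (x + t • e) (t * c) (by
      intro z hz a ha
      have hz' : z ∈ Metric.ball x r := by
        have hx' : x + t • e ∈ Metric.ball x r := by
          simp [norm_smul, abs_of_pos ht, htr]
        exact (convex_ball x r).segment_subset (Metric.mem_ball_self hr) hx' hz
      have : inner ℝ a e ≤ c := by
        by_contra hlt
        have := hball z hz' a ⟨by simpa using hK a z ha, (not_le.1 hlt).le⟩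
        linarith
      rw [add_sub_cancel_left, real_inner_smul_right]
      exact mul_le_mul_of_nonneg_left this ht.le)
    simp only [add_sub_cancel_left, real_inner_smul_right, norm_smul, Real.norm_eq_abs, abs_of_pos ht] at h1 h2
    linarith
  -- let `t → 0`
  have hlim : Filter.Tendsto (fun t : ℝ => inner ℝ p e - C * t * ‖e‖ ^ 2) (𝓝[>] 0) (𝓝 (inner ℝ p e)) := by
    have : Continuous (fun t : ℝ => inner ℝ p e - C * t * ‖e‖ ^ 2) := by fun_prop
    have h := (this.tendsto 0).mono_left (nhdsWithin_le_nhds (s := Ioi 0))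
    simpa using h
  have hle : inner ℝ p e ≤ c := by
    refine le_of_tendsto hlim ?_
    have hsmall : ∀ᶠ t : ℝ in 𝓝[>] 0, t * ‖e‖ < r := by
      have : Continuous (fun t : ℝ => t * ‖e‖) := by fun_prop
      have h := (this.tendsto 0).mono_left (nhdsWithin_le_nhds (s := Ioi 0))
      exact h.eventually_lt_const (by simpa using hr)
    filter_upwards [hsmall, self_mem_nhdsWithin] with t h1 (h2 : 0 < t)
    have := hstep t h2 h1
    have h3 : t * (inner ℝ p e - C * t * ‖e‖ ^ 2) ≤ t * c := by nlinarith
    exact le_of_mul_le_mul_left h3 h2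
  linarith

/-- supersolution property (Perron bump) -/
lemma dm_super {H : E → E → ℝ} {m K : ℝ}
    (hH : Continuous (fun q : E × E => H q.1 q.2))
    (hK : ∀ a z, H a z ≤ m → ‖a‖ ≤ K) (h0 : ∀ z, H 0 z ≤ m) {x y p : E} {C : ℝ} (hC : 0 ≤ C)
    (hxy : x ≠ y)
    (hp : ∀ z, dm H m x y + inner ℝ p (z - x) - C * ‖z - x‖ ^ 2 ≤ dm H m z y) : m ≤ H p x := by
  by_contra hcon
  rw [not_le] at hcon
  have hc : Continuous (fun w : E => H (p - (2 * (C + 1)) • (w - x)) w) :=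
    hH.comp (by fun_prop : Continuous fun w : E => (p - (2 * (C + 1)) • (w - x), w))
  have hev : ∀ᶠ w in 𝓝 x, H (p - (2 * (C + 1)) • (w - x)) w < m :=
    hc.continuousAt.eventually_lt_const (by simpa using hcon)
  obtain ⟨r₀, hr₀, hball⟩ := Metric.eventually_nhds_iff_ball.1 hev
  have hxy' : 0 < ‖y - x‖ := norm_pos_iff.2 (sub_ne_zero.2 hxy.symm)
  set r := min (r₀ / 2) ‖y - x‖ with hr
  have hrpos : 0 < r := lt_min (by linarith) hxy'
  have hrr : r < r₀ := (min_le_left _ _).trans_lt (by linarith)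
  set φ : E → ℝ := fun z => dm H m x y + inner ℝ p (z - x) - (C + 1) * ‖z - x‖ ^ 2 + r ^ 2 / 2 with hφ
  have hφout : ∀ z, r ≤ ‖z - x‖ → φ z ≤ dm H m z y := by
    intro z hz
    have := hp z
    have h2 : r ^ 2 ≤ ‖z - x‖ ^ 2 := by gcongr
    simp only [hφ]
    nlinarith [sq_nonneg r]
  have hφconc : ∀ z w, φ z - φ w ≤ inner ℝ (p - (2 * (C + 1)) • (w - x)) (z - w) := by
    intro z w
    have h1 : z - x = (z - w) + (w - x) := by abel
    have h2 : ‖z - x‖ ^ 2 = ‖z - w‖ ^ 2 + 2 * inner ℝ (w - x) (z - w) + ‖w - x‖ ^ 2 := by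
      rw [h1, norm_add_sq_real, real_inner_comm]
    simp only [hφ]
    have h3 : inner ℝ (p - (2 * (C + 1)) • (w - x)) (z - w) =
        inner ℝ p (z - w) - 2 * (C + 1) * inner ℝ (w - x) (z - w) := by
      rw [inner_sub_left, real_inner_smul_left]
    rw [h3, h2, h1, inner_add_right]
    nlinarith [sq_nonneg ‖z - w‖]
  have hv : Adm H m (fun z => max (dm H m z y) (φ z)) := by
    intro x₁ x₂ c h
    have hbase := dm_adm hK h0 y x₁ x₂ c h
    simp only at hbase ⊢
    rcases le_total (φ x₂) (dm H m x₂ y) with hle | hle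
    · rw [max_eq_left hle]
      have := le_max_left (dm H m x₁ y) (φ x₁)
      linarith
    rw [max_eq_right hle]
    -- gradient of the bump is admissible
    have hgrad : ∀ w, ‖w - x‖ ≤ r → H (p - (2 * (C + 1)) • (w - x)) w ≤ m := by
      intro w hw
      exact (hball w (by rw [mem_ball_iff_norm]; linarith)).le
    by_cases h1 : ‖x₁ - x‖ ≤ r
    · have h2 := hφconc x₂ x₁
      have h3 := h x₁ (left_mem_segment ℝ _ _) _ (hgrad x₁ h1)
      have := le_max_right (dm H m x₁ y) (φ x₁)
      linarith
    by_cases h2 : r ≤ ‖x₂ - x‖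
    · have := hφout x₂ h2
      have := le_max_left (dm H m x₁ y) (φ x₁)
      linarith
    -- crossing point
    have hcont : ContinuousOn (fun θ : ℝ => ‖x₁ + θ • (x₂ - x₁) - x‖) (Icc 0 1) := by fun_prop
    have hivt := intermediate_value_Icc' (zero_le_one' ℝ) hcont
    obtain ⟨θ, ⟨hθ0, hθ1⟩, hθ⟩ := hivt (show r ∈ _ by
      simp only [one_smul, zero_smul, add_zero, add_sub_cancel]
      exact ⟨(not_le.1 h2).le, (not_le.1 h1).le⟩)
    simp only at hθ
    set w := x₁ + θ • (x₂ - x₁) with hw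
    have hwseg : w ∈ segment ℝ x₁ x₂ := by
      rw [segment_eq_image']
      exact ⟨θ, ⟨hθ0, hθ1⟩, rfl⟩
    have hA : dm H m w y - dm H m x₁ y ≤ θ * c := by
      refine dm_adm hK h0 y x₁ w (θ * c) fun z hz a ha => ?_
      have hz' : z ∈ segment ℝ x₁ x₂ :=
        (convex_segment x₁ x₂).segment_subset (left_mem_segment ℝ _ _) hwseg hz
      have := h z hz' a ha
      rw [hw, add_sub_cancel_left, real_inner_smul_right]
      exact mul_le_mul_of_nonneg_left this hθ0
    have hB : φ x₂ - φ w ≤ (1 - θ) * c := by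
      refine (hφconc x₂ w).trans ?_
      have h3 := h w hwseg _ (hgrad w hθ.le)
      have : x₂ - w = (1 - θ) • (x₂ - x₁) := by rw [hw]; module
      rw [this, real_inner_smul_right]
      exact mul_le_mul_of_nonneg_left h3 (by linarith)
    have h3 := hφout w hθ.ge
    have := le_max_left (dm H m x₁ y) (φ x₁)
    nlinarith
  have hfin := le_dm hK hv x y
  have hy : φ y ≤ dm H m y y := hφout y (min_le_right _ _)
  rw [max_eq_left hy, dm_self hK h0] at hfin
  have := le_max_right (dm H m x y) (φ x)
  simp only [hφ, sub_self, inner_zero_right, norm_zero] at this hfin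
  nlinarith [sq_pos_of_pos hrpos]

/-- both gradients of the metric solve the eikonal equation at subdifferentials -/
lemma dm_eikonal [FiniteDimensional ℝ E] {H : E → E → ℝ} {m K : ℝ}
    (hH : Continuous (fun q : E × E => H q.1 q.2))
    (hconv : ∀ x, ConvexOn ℝ univ (fun p => H p x))
    (hK : ∀ a z, H a z ≤ m → ‖a‖ ≤ K) (h0 : ∀ z, H 0 z ≤ m) {x y p : E} {C : ℝ} (hC : 0 ≤ C)
    (hxy : x ≠ y)
    (hp : ∀ z, dm H m x y + inner ℝ p (z - x) - C * ‖z - x‖ ^ 2 ≤ dm H m z y) : H p x = m :=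
  le_antisymm (dm_sub hH hconv hK h0 hp) (dm_super hH hK h0 hC hxy hp)

lemma dm_eikonal' [FiniteDimensional ℝ E] {H : E → E → ℝ} {m K : ℝ}
    (hH : Continuous (fun q : E × E => H q.1 q.2))
    (hconv : ∀ x, ConvexOn ℝ univ (fun p => H p x))
    (hK : ∀ a z, H a z ≤ m → ‖a‖ ≤ K) (h0 : ∀ z, H 0 z ≤ m) {x y p : E} {C : ℝ} (hC : 0 ≤ C)
    (hxy : x ≠ y)
    (hp : ∀ z, dm H m x y + inner ℝ p (z - y) - C * ‖z - y‖ ^ 2 ≤ dm H m x z) : H (-p) y = m := by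
  refine dm_eikonal (H := fun a z => H (-a) z) (K := K) (x := y) (y := x) (p := p) (C := C)
    (hH.comp (by fun_prop : Continuous fun q : E × E => (-q.1, q.2))) (fun z => ?_)
    (fun a z h => by simpa using hK _ _ h) (fun z => by simpa using h0 z) hC hxy.symm ?_
  · have := (hconv z).comp_linearMap (-LinearMap.id : E →ₗ[ℝ] E)
    exact this
  · intro z
    rw [dm_symm, dm_symm]
    exact hp z

/-- uniform Lipschitz bound of convex functions in `p`. -/
lemma conv_lip {f : E → ℝ} (hf : ConvexOn ℝ univ f) {K B : ℝ} 
    (hB : ∀ p q, ‖p‖ ≤ K + 2 → ‖q‖ ≤ K + 2 → f p - f q ≤ B) {p h : E} (hp : ‖p‖ ≤ K) (hh : ‖h‖ ≤ 1) :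
    |f (p + h) - f p| ≤ B * ‖h‖ := by
  have key : ∀ p h : E, ‖p‖ ≤ K + 1 → ‖h‖ ≤ 1 → f (p + h) - f p ≤ B * ‖h‖ := by
    intro p h hp hh
    rcases eq_or_ne h 0 with rfl | hne
    · simp
    have hn : ‖h‖ ≠ 0 := norm_ne_zero_iff.2 hne
    have h1 := hf.2 (mem_univ p) (mem_univ (p + (1 / ‖h‖) • h))
      (show 0 ≤ 1 - ‖h‖ by linarith) (norm_nonneg h) (by ring)
    have h2 : (1 - ‖h‖) • p + ‖h‖ • (p + (1 / ‖h‖) • h) = p + h := by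
      rw [smul_add, smul_smul, mul_one_div_cancel hn]; module
    rw [h2] at h1
    have h3 := hB (p + (1 / ‖h‖) • h) p (by
      refine (norm_add_le _ _).trans ?_
      rw [norm_smul]
      simp [hn]
      linarith) (by linarith)
    simp only [smul_eq_mul] at h1
    nlinarith [norm_nonneg h]
  rw [abs_le]
  have h1 := key p h (by linarith) hh
  have h2 := key (p + h) (-h) ((norm_add_le _ _).trans (by linarith)) (by simpa using hh)
  simp only [add_neg_cancel_right, norm_neg] at h2
  constructor <;> linarith

end metric

section pen
variable {E : Type*} [NormedAddCommGroup E] [InnerProductSpace ℝ E]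

/-- the penalised doubled functional -/
def Phi (u : E → ℝ → ℝ) (D : E → E → ℝ) (P : ℝ → ℝ) (β N : ℝ) (x y x' y' : E) (t s : ℝ) : ℝ :=
  u x t - u y s - D x' y' - N * (‖x - x'‖ ^ 2 + ‖y - y'‖ ^ 2 + (t - s) ^ 2)
    - β * (‖x‖ ^ 2 + ‖y‖ ^ 2) - P t

lemma Phi_bounds {u : E → ℝ → ℝ} {D : E → E → ℝ} {P : ℝ → ℝ} {β N M T2 : ℝ}
    (hD0 : ∀ x y, 0 ≤ D x y) (hP0 : ∀ t, 0 ≤ P t) (hβ : 0 < β) (hN : 1 ≤ N)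
    (hM : ∀ x, ∀ t ∈ Icc (0 : ℝ) T2, |u x t| ≤ M) {x y x' y' : E} {t s : ℝ}
    (ht : t ∈ Icc 0 T2) (hs : s ∈ Icc 0 T2) (h : 0 ≤ Phi u D P β N x y x' y' t s) :
    β * (‖x‖ ^ 2 + ‖y‖ ^ 2) ≤ 2 * M ∧
      N * (‖x - x'‖ ^ 2 + ‖y - y'‖ ^ 2 + (t - s) ^ 2) ≤ 2 * M ∧ P t ≤ 2 * M := by
  unfold Phi at h
  have h1 := abs_le.1 (hM x t ht)
  have h2 := abs_le.1 (hM y s hs)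
  have h3 := hD0 x' y'
  have h4 := hP0 t
  have h5 : 0 ≤ N * (‖x - x'‖ ^ 2 + ‖y - y'‖ ^ 2 + (t - s) ^ 2) := by positivity
  have h6 : 0 ≤ β * (‖x‖ ^ 2 + ‖y‖ ^ 2) := by positivity
  refine ⟨?_, ?_, ?_⟩ <;> linarith

lemma exists_max [FiniteDimensional ℝ E] {u : E → ℝ → ℝ} {D : E → E → ℝ} {P : ℝ → ℝ} {β N M T2 : ℝ}
    (hu : ContinuousOn (fun q : E × ℝ => u q.1 q.2) (univ ×ˢ Ici (0 : ℝ)))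
    (hD : Continuous (fun q : E × E => D q.1 q.2)) (hP : Continuous P)
    (hD0 : ∀ x y, 0 ≤ D x y) (hP0 : ∀ t, 0 ≤ P t) (hβ : 0 < β) (hN : 1 ≤ N) 
    (hM : ∀ x, ∀ t ∈ Icc (0 : ℝ) T2, |u x t| ≤ M) {x₀ y₀ : E} {T : ℝ} (hT : T ∈ Icc 0 T2)
    (href : 0 ≤ Phi u D P β N x₀ y₀ x₀ y₀ T T) :
    ∃ x y x' y' t s, t ∈ Icc 0 T2 ∧ s ∈ Icc 0 T2 ∧
      (∀ X Y X' Y' t2 s2, t2 ∈ Icc 0 T2 → s2 ∈ Icc 0 T2 →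
        Phi u D P β N X Y X' Y' t2 s2 ≤ Phi u D P β N x y x' y' t s) := by
  have hM0 : 0 ≤ M := (abs_nonneg _).trans (hM x₀ T hT)
  set R := 2 * M / β + 1 with hR
  have hR1 : 1 ≤ R := by
    have : 0 ≤ 2 * M / β := by positivity
    linarith
  have hβR : β * R = 2 * M + β := by rw [hR]; field_simp
  set B := R + (2 * M + 1) with hB
  have inbox : ∀ X Y X' Y' t2 s2, t2 ∈ Icc 0 T2 → s2 ∈ Icc 0 T2 →
      0 ≤ Phi u D P β N X Y X' Y' t2 s2 → ‖X‖ ≤ B ∧ ‖Y‖ ≤ B ∧ ‖X'‖ ≤ B ∧ ‖Y'‖ ≤ B := by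
    intro X Y X' Y' t2 s2 ht2 hs2 hpos
    obtain ⟨h1, h2, -⟩ := Phi_bounds hD0 hP0 hβ hN hM ht2 hs2 hpos
    have small : ∀ Z : E, β * ‖Z‖ ^ 2 ≤ 2 * M → ‖Z‖ ≤ R := by
      intro Z hZ
      by_contra hlt
      rw [not_le] at hlt
      have : R * 1 ≤ ‖Z‖ ^ 2 := by nlinarith
      nlinarith
    have hX := small X (by nlinarith [sq_nonneg ‖Y‖])
    have hY := small Y (by nlinarith [sq_nonneg ‖X‖])
    have h3 : ‖X - X'‖ ^ 2 + ‖Y - Y'‖ ^ 2 + (t2 - s2) ^ 2 ≤ 2 * M := by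
      have : 0 ≤ ‖X - X'‖ ^ 2 + ‖Y - Y'‖ ^ 2 + (t2 - s2) ^ 2 := by positivity
      nlinarith
    have h4 : ‖X - X'‖ ≤ 2 * M + 1 := by
      nlinarith [sq_nonneg ‖Y - Y'‖, sq_nonneg (t2 - s2), sq_nonneg (‖X - X'‖ - 1)]
    have h5 : ‖Y - Y'‖ ≤ 2 * M + 1 := by
      nlinarith [sq_nonneg ‖X - X'‖, sq_nonneg (t2 - s2), sq_nonneg (‖Y - Y'‖ - 1)]
    have h6 : ‖X'‖ ≤ ‖X‖ + ‖X - X'‖ := by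
      have := norm_sub_le X (X - X'); simpa using this
    have h7 : ‖Y'‖ ≤ ‖Y‖ + ‖Y - Y'‖ := by
      have := norm_sub_le Y (Y - Y'); simpa using this
    refine ⟨?_, ?_, ?_, ?_⟩ <;> linarith
  let S : Set (E × E × E × E × ℝ × ℝ) :=
    Metric.closedBall 0 B ×ˢ Metric.closedBall 0 B ×ˢ Metric.closedBall 0 B ×ˢ
      Metric.closedBall 0 B ×ˢ Icc 0 T2 ×ˢ Icc 0 T2
  have hS : IsCompact S :=
    (isCompact_closedBall _ _).prod ((isCompact_closedBall _ _).prod ((isCompact_closedBall _ _).prod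
      ((isCompact_closedBall _ _).prod (isCompact_Icc.prod isCompact_Icc))))
  have hmem : ∀ X Y X' Y' t2 s2, t2 ∈ Icc 0 T2 → s2 ∈ Icc 0 T2 →
      0 ≤ Phi u D P β N X Y X' Y' t2 s2 → (X, Y, X', Y', t2, s2) ∈ S := by
    intro X Y X' Y' t2 s2 ht2 hs2 hpos
    obtain ⟨h1, h2, h3, h4⟩ := inbox X Y X' Y' t2 s2 ht2 hs2 hpos
    simp only [S, mem_prod, mem_closedBall_zero_iff]
    exact ⟨h1, h2, h3, h4, ht2, hs2⟩
  have hcont : ContinuousOn (fun q : E × E × E × E × ℝ × ℝ =>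
      Phi u D P β N q.1 q.2.1 q.2.2.1 q.2.2.2.1 q.2.2.2.2.1 q.2.2.2.2.2) S := by
    unfold Phi
    have c1 : ContinuousOn (fun q : E × E × E × E × ℝ × ℝ => u q.1 q.2.2.2.2.1) S :=
      hu.comp (f := fun q : E × E × E × E × ℝ × ℝ => (q.1, q.2.2.2.2.1))
        (Continuous.continuousOn (by fun_prop)) (fun q hq => ⟨mem_univ _, hq.2.2.2.2.1.1⟩)
    have c2 : ContinuousOn (fun q : E × E × E × E × ℝ × ℝ => u q.2.1 q.2.2.2.2.2) S :=
      hu.comp (f := fun q : E × E × E × E × ℝ × ℝ => (q.2.1, q.2.2.2.2.2))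
        (Continuous.continuousOn (by fun_prop)) (fun q hq => ⟨mem_univ _, hq.2.2.2.2.2.1⟩)
    have c3 : Continuous (fun q : E × E × E × E × ℝ × ℝ => D q.2.2.1 q.2.2.2.1) :=
      hD.comp (by fun_prop : Continuous fun q : E × E × E × E × ℝ × ℝ => (q.2.2.1, q.2.2.2.1))
    have c4 : Continuous (fun q : E × E × E × E × ℝ × ℝ => 
      N * (‖q.1 - q.2.2.1‖ ^ 2 + ‖q.2.1 - q.2.2.2.1‖ ^ 2 + (q.2.2.2.2.1 - q.2.2.2.2.2) ^ 2)) := by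
      fun_prop
    have c5 : Continuous (fun q : E × E × E × E × ℝ × ℝ => β * (‖q.1‖ ^ 2 + ‖q.2.1‖ ^ 2)) := by
      fun_prop
    have c6 : Continuous (fun q : E × E × E × E × ℝ × ℝ => P q.2.2.2.2.1) := by fun_prop
    exact ((((c1.sub c2).sub c3.continuousOn).sub c4.continuousOn).sub c5.continuousOn).sub
      c6.continuousOn
  have h0 := hmem x₀ y₀ x₀ y₀ T T hT hT href
  obtain ⟨⟨x, y, x', y', t, s⟩, hq, hmax⟩ := hS.exists_isMaxOn ⟨_, h0⟩ hcont
  have hq' := hq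
  simp only [S, mem_prod] at hq'
  refine ⟨x, y, x', y', t, s, hq'.2.2.2.2.1, hq'.2.2.2.2.2, ?_⟩
  intro X Y X' Y' t2 s2 ht2 hs2
  by_cases hpos : 0 ≤ Phi u D P β N X Y X' Y' t2 s2
  · exact hmax (hmem X Y X' Y' t2 s2 ht2 hs2 hpos)
  · have := hmax h0
    simp only [mem_ofPred_eq] at this
    linarith

lemma grad_quad [CompleteSpace E] (N β c₁ c₂ c₃ : ℝ) (x x' : E) :
    gradient (fun z : E => N * (‖z - x'‖ ^ 2 + c₁ + c₂) + β * (‖z‖ ^ 2 + c₃)) x =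
      (2 * N) • (x - x') + (2 * β) • x := by
  apply HasGradientAt.gradient
  rw [hasGradientAt_iff_hasFDerivAt]
  have h1 : HasFDerivAt (fun z : E => ‖z - x'‖ ^ 2) _ x := ((hasFDerivAt_id x).sub_const x').norm_sq
  have h2 : HasFDerivAt (fun z : E => ‖z‖ ^ 2) _ x := (hasFDerivAt_id x).norm_sq
  have h3 := (((h1.add_const c₁).add_const c₂).const_mul N).add ((h2.add_const c₃).const_mul β)
  refine h3.congr_fderiv ?_
  ext z
  simp [inner_add_left, real_inner_smul_left]
  ring

end pen

section main
variable {d : ℕ}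


lemma visc_step {H : EuclideanSpace ℝ (Fin d) → EuclideanSpace ℝ (Fin d) → ℝ} {g : ℝ → ℝ}
    {u : EuclideanSpace ℝ (Fin d) → ℝ → ℝ} (hsol : ViscositySolution d H g u) {m K : ℝ}
    (hH : Continuous (fun q : EuclideanSpace ℝ (Fin d) × EuclideanSpace ℝ (Fin d) => H q.1 q.2))
    (hconv : ∀ x, ConvexOn ℝ univ (fun p => H p x))
    (hK : ∀ a z, H a z ≤ m → ‖a‖ ≤ K) (h0 : ∀ z, H 0 z ≤ m)
    {P : ℝ → ℝ} (hP : ContDiff ℝ 1 P) {β N T2 : ℝ} (hN : 1 ≤ N)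
    {x y x' y' : EuclideanSpace ℝ (Fin d)} {t s : ℝ} (ht : t ∈ Ioo 0 T2) (hs : s ∈ Ioo 0 T2)
    (hmax : ∀ X Y X' Y' t2 s2, t2 ∈ Icc 0 T2 → s2 ∈ Icc 0 T2 →
        Phi u (dm H m) P β N X Y X' Y' t2 s2 ≤ Phi u (dm H m) P β N x y x' y' t s)
    (hxy : x' ≠ y') :
    ∃ a b, H a x' = m ∧ H b y' = m ∧
      deriv P t ≤ H (a + (2 * β) • x) x * g t - H (b - (2 * β) • y) y * g s := by
  have htI := Ioo_subset_Icc_self ht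
  have hsI := Ioo_subset_Icc_self hs
  refine ⟨(2 * N) • (x - x'), -((2 * N) • (y - y')), ?_, ?_, ?_⟩
  · refine dm_eikonal hH hconv hK h0 (C := N) (by linarith) hxy fun z => ?_
    have h := hmax x y z y' t s htI hsI
    unfold Phi at h
    have e : ‖x - z‖ ^ 2 = ‖x - x'‖ ^ 2 - 2 * inner ℝ (x - x') (z - x') + ‖z - x'‖ ^ 2 := by
      rw [← norm_sub_sq_real]; congr 2; abel
    rw [e] at h
    rw [real_inner_smul_left]
    nlinarith
  · refine dm_eikonal' hH hconv hK h0 (C := N) (by linarith) hxy fun z => ?_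
    have h := hmax x y x' z t s htI hsI
    unfold Phi at h
    have e : ‖y - z‖ ^ 2 = ‖y - y'‖ ^ 2 - 2 * inner ℝ (y - y') (z - y') + ‖z - y'‖ ^ 2 := by
      rw [← norm_sub_sq_real]; congr 2; abel
    rw [e] at h
    rw [real_inner_smul_left]
    nlinarith
  have hopen : ∀ (w : EuclideanSpace ℝ (Fin d)) (r : ℝ), r ∈ Ioo 0 T2 →
      ∀ᶠ q : EuclideanSpace ℝ (Fin d) × ℝ in 𝓝[{q : EuclideanSpace ℝ (Fin d) × ℝ | 0 < q.2}] (w, r), q.2 ∈ Icc 0 T2 := by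
    intro w r hr
    refine Filter.Eventually.filter_mono nhdsWithin_le_nhds ?_
    have : ∀ᶠ r' in 𝓝 r, r' ∈ Icc 0 T2 := Icc_mem_nhds hr.1 hr.2
    exact continuous_snd.continuousAt.eventually this
  -- subsolution
  have hsub := hsol.1 (fun q => (N * (‖q.1 - x'‖ ^ 2 + ‖y - y'‖ ^ 2 + (q.2 - s) ^ 2)
      + β * (‖q.1‖ ^ 2 + ‖y‖ ^ 2)) + P q.2)
    (by
      have c1 : ContDiff ℝ 1 (fun q : EuclideanSpace ℝ (Fin d) × ℝ => ‖q.1 - x'‖ ^ 2) :=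
        (contDiff_fst.sub contDiff_const).norm_sq ℝ
      have c2 : ContDiff ℝ 1 (fun q : EuclideanSpace ℝ (Fin d) × ℝ => ‖q.1‖ ^ 2) := contDiff_fst.norm_sq ℝ
      have c3 : ContDiff ℝ 1 (fun q : EuclideanSpace ℝ (Fin d) × ℝ => P q.2) := hP.comp contDiff_snd
      fun_prop) x t ht.1
    (by
      filter_upwards [hopen x t ht] with q hq
      have h := hmax q.1 y x' y' q.2 s hq hsI
      unfold Phi at h
      linarith)
  -- supersolution
  have hsup := hsol.2 (fun q => (-N) * (‖q.1 - y'‖ ^ 2 + ‖x - x'‖ ^ 2 + (t - q.2) ^ 2)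
      + (-β) * (‖q.1‖ ^ 2 + ‖x‖ ^ 2))
    (by
      have c1 : ContDiff ℝ 1 (fun q : EuclideanSpace ℝ (Fin d) × ℝ => ‖q.1 - y'‖ ^ 2) :=
        (contDiff_fst.sub contDiff_const).norm_sq ℝ
      have c2 : ContDiff ℝ 1 (fun q : EuclideanSpace ℝ (Fin d) × ℝ => ‖q.1‖ ^ 2) := contDiff_fst.norm_sq ℝ
      fun_prop) y s hs.1
    (by
      filter_upwards [hopen y s hs] with q hq
      have h := hmax x q.1 x' y' t q.2 htI hq
      unfold Phi at h
      linarith)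
  have g1 : gradient (fun z : EuclideanSpace ℝ (Fin d) => (N * (‖z - x'‖ ^ 2 + ‖y - y'‖ ^ 2 + (t - s) ^ 2)
      + β * (‖z‖ ^ 2 + ‖y‖ ^ 2)) + P t) x = (2 * N) • (x - x') + (2 * β) • x := by
    rw [← grad_quad N β (‖y - y'‖ ^ 2) ((t - s) ^ 2) (‖y‖ ^ 2) x x']
    unfold gradient
    rw [fderiv_add_const]
  have g2 := grad_quad (-N) (-β) (‖x - x'‖ ^ 2) ((t - s) ^ 2) (‖x‖ ^ 2) y y'
  have hPd : HasDerivAt P (deriv P t) t := (hP.differentiable (by norm_num) t).hasDerivAt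
  have d1 : deriv (fun r => (N * (‖x - x'‖ ^ 2 + ‖y - y'‖ ^ 2 + (r - s) ^ 2)
      + β * (‖x‖ ^ 2 + ‖y‖ ^ 2)) + P r) t = 2 * N * (t - s) + deriv P t := by
    have h1 : HasDerivAt (fun r : ℝ => (r - s) ^ 2) (2 * (t - s)) t := by
      simpa using ((hasDerivAt_id t).sub_const s).fun_pow 2
    have h2 := ((((h1.const_add (‖x - x'‖ ^ 2 + ‖y - y'‖ ^ 2)).const_mul N).add_const
      (β * (‖x‖ ^ 2 + ‖y‖ ^ 2))).add hPd).deriv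
    refine Eq.trans h2 ?_
    ring
  have d2 : deriv (fun r => (-N) * (‖y - y'‖ ^ 2 + ‖x - x'‖ ^ 2 + (t - r) ^ 2)
      + (-β) * (‖y‖ ^ 2 + ‖x‖ ^ 2)) s = 2 * N * (t - s) := by
    have h1 : HasDerivAt (fun r : ℝ => (t - r) ^ 2) (- (2 * (t - s))) s := by
      simpa using ((hasDerivAt_id s).const_sub t).fun_pow 2
    have h2 := (((h1.const_add (‖y - y'‖ ^ 2 + ‖x - x'‖ ^ 2)).const_mul (-N)).add_const
      ((-β) * (‖y‖ ^ 2 + ‖x‖ ^ 2))).deriv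
    refine Eq.trans h2 ?_
    ring
  simp only at hsub hsup
  rw [g1, d1] at hsub
  rw [g2, d2] at hsup
  have e : (2 * -N) • (y - y') + (2 * -β) • y = -((2 * N) • (y - y')) - (2 * β) • y := by module
  rw [e] at hsup
  linarith

set_option maxHeartbeats 1600000 in
lemma comparison {H : EuclideanSpace ℝ (Fin d) → EuclideanSpace ℝ (Fin d) → ℝ} {g : ℝ → ℝ}
    {u : EuclideanSpace ℝ (Fin d) → ℝ → ℝ} (hsol : ViscositySolution d H g u) {m K Λ : ℝ}
    (hg : ContinuousOn g (Ici 0))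
    (hu : ContinuousOn (fun q : EuclideanSpace ℝ (Fin d) × ℝ => u q.1 q.2) (univ ×ˢ Ici (0 : ℝ)))
    (hubdd : ∀ T > (0 : ℝ), ∃ M, ∀ x, ∀ t ∈ Icc (0 : ℝ) T, |u x t| ≤ M)
    (hH : Continuous (fun q : EuclideanSpace ℝ (Fin d) × EuclideanSpace ℝ (Fin d) => H q.1 q.2))
    (hconv : ∀ x, ConvexOn ℝ univ (fun p => H p x))
    (hK : ∀ a z, H a z ≤ m → ‖a‖ ≤ K) (h0 : ∀ z, H 0 z ≤ m) (hΛ0 : 0 ≤ Λ)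
    (hΛ : ∀ x a h, ‖a‖ ≤ K → ‖h‖ ≤ 1 → |H (a + h) x - H a x| ≤ Λ * ‖h‖)
    (hinit : ∀ x y, u x 0 - u y 0 ≤ dm H m x y) {T : ℝ} (hT : 0 < T)
    (x₀ y₀ : EuclideanSpace ℝ (Fin d)) : u x₀ T - u y₀ T ≤ dm H m x₀ y₀ := by
  by_contra hcon
  rw [not_le] at hcon
  have hKn : 0 ≤ K := by simpa using hK 0 x₀ (h0 x₀)
  obtain ⟨c, hc, hc3⟩ : ∃ c > 0, 3 * c ≤ u x₀ T - u y₀ T - dm H m x₀ y₀ :=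
    ⟨(u x₀ T - u y₀ T - dm H m x₀ y₀) / 3, by linarith, by linarith⟩
  obtain ⟨M, hM0, hM⟩ : ∃ M > 0, ∀ x, ∀ t ∈ Icc (0 : ℝ) (2 * T), |u x t| ≤ M := by
    obtain ⟨M, hM⟩ := hubdd (2 * T) (by linarith)
    exact ⟨max M 1, by positivity, fun x t ht => (hM x t ht).trans (le_max_left _ _)⟩
  set k := 2 * M / (c * T) with hk
  have hk0 : 0 < k := by positivity
  set P : ℝ → ℝ := fun t => c * Real.exp (k * (t - T)) with hPdef
  have hP : ContDiff ℝ 1 P := by rw [hPdef]; fun_prop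
  have hP0 : ∀ t, 0 ≤ P t := fun t => by simp only [hPdef]; positivity
  have hPT : P T = c := by simp [hPdef]
  have hP2T : c + 2 * M ≤ P (2 * T) := by
    simp only [hPdef]
    have h1 := Real.add_one_le_exp (k * (2 * T - T))
    have h2 : c * (k * (2 * T - T)) = 2 * M := by rw [hk]; field_simp; ring
    nlinarith
  set κ := c * (Real.exp (-(k * T)) * k) with hκ
  have hκ0 : 0 < κ := by positivity
  have hPder : ∀ t, 0 ≤ t → κ ≤ deriv P t := by
    intro t ht
    have h1 : HasDerivAt (fun t : ℝ => k * (t - T)) k t := by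
      simpa using ((hasDerivAt_id t).sub_const T).const_mul k
    have h2 : deriv P t = c * (Real.exp (k * (t - T)) * k) := (h1.exp.const_mul c).deriv
    rw [h2, hκ]
    gcongr
    nlinarith
  obtain ⟨G, hG⟩ := (isCompact_Icc (a := 0) (b := 2 * T)).exists_bound_of_continuousOn
    (hg.mono Icc_subset_Ici_self)
  have hG0 : 0 ≤ G := (norm_nonneg _).trans (hG 0 ⟨le_rfl, by linarith⟩)
  obtain ⟨τ, hτ0, hτ1, hτ⟩ : ∃ τ > 0, τ ≤ 1 ∧ 2 * (Λ * τ) * G < κ := by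
    have hden : 0 < 4 * (Λ + 1) * (G + 1) := by positivity
    refine ⟨min 1 (κ / (4 * (Λ + 1) * (G + 1))), lt_min one_pos (by positivity), min_le_left _ _, ?_⟩
    set τ := min 1 (κ / (4 * (Λ + 1) * (G + 1)))
    have hpos : 0 < τ := lt_min one_pos (by positivity)
    have h1 : τ * (4 * (Λ + 1) * (G + 1)) ≤ κ := by
      rw [← le_div_iff₀ hden]; exact min_le_right _ _
    have h2 : Λ * G * τ ≤ (Λ + 1) * (G + 1) * τ := by
      gcongr <;> linarith
    nlinarith
  obtain ⟨β, hβ, hβ1, hβ2⟩ : ∃ β > 0, 8 * M * β ≤ τ ^ 2 ∧ β * (‖x₀‖ ^ 2 + ‖y₀‖ ^ 2) ≤ c := by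
    have hs : 0 < ‖x₀‖ ^ 2 + ‖y₀‖ ^ 2 + 1 := by positivity
    refine ⟨min (τ ^ 2 / (8 * M)) (c / (‖x₀‖ ^ 2 + ‖y₀‖ ^ 2 + 1)),
      lt_min (by positivity) (by positivity), ?_, ?_⟩
    · have h1 := min_le_left (τ ^ 2 / (8 * M)) (c / (‖x₀‖ ^ 2 + ‖y₀‖ ^ 2 + 1))
      rw [le_div_iff₀ (by positivity)] at h1
      linarith
    · have h1 := min_le_right (τ ^ 2 / (8 * M)) (c / (‖x₀‖ ^ 2 + ‖y₀‖ ^ 2 + 1))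
      have hpos : 0 < min (τ ^ 2 / (8 * M)) (c / (‖x₀‖ ^ 2 + ‖y₀‖ ^ 2 + 1)) :=
        lt_min (by positivity) (by positivity)
      rw [le_div_iff₀ hs] at h1
      linarith
  have hd0 := dm_nonneg hK h0
  have hdc := dm_continuous hK h0
  have href : ∀ N, c ≤ Phi u (dm H m) P β N x₀ y₀ x₀ y₀ T T := by
    intro N
    unfold Phi
    simp only [hPT, sub_self, norm_zero]
    linarith
  have hTI : T ∈ Icc 0 (2 * T) := ⟨hT.le, by linarith⟩
  have hseq : ∀ n : ℕ, ∃ x y x' y' t s a b, t ∈ Icc 0 (2 * T) ∧ s ∈ Icc 0 (2 * T) ∧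
      c ≤ Phi u (dm H m) P β (n + 1) x y x' y' t s ∧ ‖a‖ ≤ K ∧ ‖b‖ ≤ K ∧
      (t ∈ Ioo 0 (2 * T) → s ∈ Ioo 0 (2 * T) → x' ≠ y' → H a x' = m ∧ H b y' = m ∧
        κ ≤ H (a + (2 * β) • x) x * g t - H (b - (2 * β) • y) y * g s) := by
    intro n
    have hN : (1 : ℝ) ≤ n + 1 := by
      have : (0 : ℝ) ≤ n := Nat.cast_nonneg n
      linarith
    obtain ⟨x, y, x', y', t, s, ht, hs, hmax⟩ := exists_max hu hdc hP.continuous hd0 hP0 hβ hN hM hTI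
      (hc.le.trans (href _))
    have hval := (href (n + 1)).trans (hmax x₀ y₀ x₀ y₀ T T hTI hTI)
    by_cases hcase : t ∈ Ioo 0 (2 * T) ∧ s ∈ Ioo 0 (2 * T) ∧ x' ≠ y'
    · obtain ⟨a, b, ha, hb, hab⟩ := visc_step hsol hH hconv hK h0 hP hN hcase.1 hcase.2.1 hmax hcase.2.2
      exact ⟨x, y, x', y', t, s, a, b, ht, hs, hval, hK a _ ha.le, hK b _ hb.le,
        fun _ _ _ => ⟨ha, hb, (hPder t ht.1).trans hab⟩⟩
    · exact ⟨x, y, x', y', t, s, 0, 0, ht, hs, hval, by simpa using hKn, by simpa using hKn,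
        fun h1 h2 h3 => absurd ⟨h1, h2, h3⟩ hcase⟩
  choose x y x' y' t s a b ht hs hval ha hb hprop using hseq
  have hbd := fun n : ℕ => Phi_bounds hd0 hP0 hβ
    (show (1 : ℝ) ≤ (n : ℝ) + 1 by have : (0 : ℝ) ≤ n := Nat.cast_nonneg n; linarith) hM (ht n) (hs n)
    (hc.le.trans (hval n))
  set R := 2 * M / β + 1 with hR
  have hxR : ∀ n, ‖x n‖ ≤ R ∧ ‖y n‖ ≤ R := by
    intro n
    have h1 := (hbd n).1
    have h2 : ‖x n‖ ^ 2 + ‖y n‖ ^ 2 ≤ 2 * M / β := by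
      rw [le_div_iff₀ hβ]; linarith
    constructor
    · nlinarith [sq_nonneg (‖x n‖ - 1), sq_nonneg ‖y n‖, sq_nonneg ‖x n‖]
    · nlinarith [sq_nonneg (‖y n‖ - 1), sq_nonneg ‖y n‖, sq_nonneg ‖x n‖]
  obtain ⟨⟨xb, yb, tb, ab, bb⟩, hmem, ψ, hψ, hlim⟩ :=
    ((isCompact_closedBall (0 : EuclideanSpace ℝ (Fin d)) R).prod
      ((isCompact_closedBall (0 : EuclideanSpace ℝ (Fin d)) R).prod
      ((isCompact_Icc (a := (0 : ℝ)) (b := 2 * T)).prod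
      ((isCompact_closedBall (0 : EuclideanSpace ℝ (Fin d)) K).prod
      (isCompact_closedBall (0 : EuclideanSpace ℝ (Fin d)) K))))).tendsto_subseq
      (x := fun n => (x n, y n, t n, a n, b n))
      (fun n => by
        simp only [mem_prod, mem_closedBall_zero_iff]
        exact ⟨(hxR n).1, (hxR n).2, ht n, ha n, hb n⟩)
  simp only [mem_prod, mem_closedBall_zero_iff] at hmem
  obtain ⟨hxb, hyb, htb, hab, hbb⟩ := hmem
  have lx : Filter.Tendsto (fun n => x (ψ n)) Filter.atTop (𝓝 xb) :=
    (continuous_fst.tendsto _).comp hlim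
  have ly : Filter.Tendsto (fun n => y (ψ n)) Filter.atTop (𝓝 yb) :=
    ((continuous_fst.comp continuous_snd).tendsto _).comp hlim
  have lt : Filter.Tendsto (fun n => t (ψ n)) Filter.atTop (𝓝 tb) :=
    ((continuous_fst.comp (continuous_snd.comp continuous_snd)).tendsto _).comp hlim
  have la : Filter.Tendsto (fun n => a (ψ n)) Filter.atTop (𝓝 ab) :=
    ((continuous_fst.comp (continuous_snd.comp (continuous_snd.comp continuous_snd))).tendsto _).comp hlim
  have lb : Filter.Tendsto (fun n => b (ψ n)) Filter.atTop (𝓝 bb) :=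
    ((continuous_snd.comp (continuous_snd.comp (continuous_snd.comp continuous_snd))).tendsto _).comp hlim
  have lsq : Filter.Tendsto (fun n : ℕ => √(2 * M * (1 / ((n : ℝ) + 1)))) Filter.atTop (𝓝 0) := by
    have h1 := (tendsto_one_div_add_atTop_nhds_zero_nat (𝕜 := ℝ)).const_mul (2 * M)
    have h2 := (Real.continuous_sqrt.tendsto _).comp h1
    rw [mul_zero, Real.sqrt_zero] at h2
    exact h2
  have lsqψ := lsq.comp hψ.tendsto_atTop
  have hsum : ∀ n, ‖x n - x' n‖ ^ 2 + ‖y n - y' n‖ ^ 2 + (t n - s n) ^ 2 ≤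
      2 * M * (1 / ((n : ℝ) + 1)) := by
    intro n
    have h1 := (hbd n).2.1
    have : (0 : ℝ) < n + 1 := by positivity
    rw [mul_one_div, le_div_iff₀ this]
    linarith
  have lx' : Filter.Tendsto (fun n => x' (ψ n)) Filter.atTop (𝓝 xb) := by
    have h : Filter.Tendsto (fun n => x (ψ n) - x' (ψ n)) Filter.atTop (𝓝 0) := by
      refine squeeze_zero_norm (fun n => ?_) lsqψ
      refine (le_abs_self _).trans (Real.abs_le_sqrt ?_)
      nlinarith [hsum (ψ n), sq_nonneg ‖y (ψ n) - y' (ψ n)‖, sq_nonneg (t (ψ n) - s (ψ n))]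
    simpa using lx.sub h
  have ly' : Filter.Tendsto (fun n => y' (ψ n)) Filter.atTop (𝓝 yb) := by
    have h : Filter.Tendsto (fun n => y (ψ n) - y' (ψ n)) Filter.atTop (𝓝 0) := by
      refine squeeze_zero_norm (fun n => ?_) lsqψ
      refine (le_abs_self _).trans (Real.abs_le_sqrt ?_)
      nlinarith [hsum (ψ n), sq_nonneg ‖x (ψ n) - x' (ψ n)‖, sq_nonneg (t (ψ n) - s (ψ n))]
    simpa using ly.sub h
  have ls : Filter.Tendsto (fun n => s (ψ n)) Filter.atTop (𝓝 tb) := by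
    have h : Filter.Tendsto (fun n => t (ψ n) - s (ψ n)) Filter.atTop (𝓝 0) := by
      refine squeeze_zero_norm (fun n => ?_) lsqψ
      refine Real.abs_le_sqrt ?_
      nlinarith [hsum (ψ n), sq_nonneg ‖x (ψ n) - x' (ψ n)‖, sq_nonneg ‖y (ψ n) - y' (ψ n)‖]
    simpa using lt.sub h
  -- limits of the functionals
  have lu : ∀ (z : ℕ → EuclideanSpace ℝ (Fin d)) (r : ℕ → ℝ) (zb : EuclideanSpace ℝ (Fin d)),
      Filter.Tendsto z Filter.atTop (𝓝 zb) → Filter.Tendsto r Filter.atTop (𝓝 tb) →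
      (∀ n, 0 ≤ r n) → Filter.Tendsto (fun n => u (z n) (r n)) Filter.atTop (𝓝 (u zb tb)) := by
    intro z r zb hz hr hpos
    have h1 := (hu (zb, tb) ⟨mem_univ _, htb.1⟩).tendsto
    refine h1.comp (f := fun n => (z n, r n)) (tendsto_nhdsWithin_iff.2 ⟨hz.prodMk_nhds hr, ?_⟩)
    exact Filter.Eventually.of_forall fun n => ⟨mem_univ _, hpos n⟩
  have lg : ∀ (r : ℕ → ℝ), Filter.Tendsto r Filter.atTop (𝓝 tb) →
      (∀ n, 0 ≤ r n) → Filter.Tendsto (fun n => g (r n)) Filter.atTop (𝓝 (g tb)) := by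
    intro r hr hpos
    exact (hg tb htb.1).tendsto.comp (tendsto_nhdsWithin_iff.2 ⟨hr, Filter.Eventually.of_forall hpos⟩)
  have lH : ∀ (z w : ℕ → EuclideanSpace ℝ (Fin d)) (zb wb : EuclideanSpace ℝ (Fin d)),
      Filter.Tendsto z Filter.atTop (𝓝 zb) → Filter.Tendsto w Filter.atTop (𝓝 wb) →
      Filter.Tendsto (fun n => H (z n) (w n)) Filter.atTop (𝓝 (H zb wb)) := by
    intro z w zb wb hz hw
    exact (hH.tendsto (zb, wb)).comp (hz.prodMk_nhds hw)
  have ld : Filter.Tendsto (fun n => dm H m (x' (ψ n)) (y' (ψ n))) Filter.atTop (𝓝 (dm H m xb yb)) :=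
    (hdc.tendsto (xb, yb)).comp (lx'.prodMk_nhds ly')
  have lP : Filter.Tendsto (fun n => P (t (ψ n))) Filter.atTop (𝓝 (P tb)) :=
    (hP.continuous.tendsto tb).comp lt
  have hlimval : c ≤ u xb tb - u yb tb - dm H m xb yb - P tb := by
    refine ge_of_tendsto ((((lu _ _ _ lx lt fun n => (ht _).1).sub
      (lu _ _ _ ly ls fun n => (hs _).1)).sub ld).sub lP) (Filter.Eventually.of_forall fun n => ?_)
    have h1 := hval (ψ n)
    unfold Phi at h1
    have h5 : 0 ≤ ((ψ n : ℝ) + 1) * (‖x (ψ n) - x' (ψ n)‖ ^ 2 + ‖y (ψ n) - y' (ψ n)‖ ^ 2 +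
      (t (ψ n) - s (ψ n)) ^ 2) := by positivity
    have h6 : 0 ≤ β * (‖x (ψ n)‖ ^ 2 + ‖y (ψ n)‖ ^ 2) := by positivity
    linarith
  have hPtb := hP0 tb
  have htb0 : 0 < tb := by
    refine lt_of_le_of_ne htb.1 fun h => ?_
    rw [← h] at hlimval hPtb
    have := hinit xb yb
    linarith
  have htb2 : tb < 2 * T := by
    refine lt_of_le_of_ne htb.2 fun h => ?_
    have h1 := abs_le.1 (hM xb tb htb)
    have h2 := abs_le.1 (hM yb tb htb)
    have h3 := hd0 xb yb
    rw [← h] at hP2T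
    linarith
  have hne : xb ≠ yb := by
    intro h
    have h3 := hd0 xb yb
    rw [h] at hlimval h3
    linarith
  have hI : Ioo 0 (2 * T) ∈ 𝓝 tb := Ioo_mem_nhds htb0 htb2
  have hneev : ∀ᶠ n in Filter.atTop, x' (ψ n) ≠ y' (ψ n) := by
    have h1 := (lx'.sub ly').eventually_ne (sub_ne_zero.2 hne)
    exact h1.mono fun n h => sub_ne_zero.1 h
  have hev : ∀ᶠ n in Filter.atTop, H (a (ψ n)) (x' (ψ n)) = m ∧ H (b (ψ n)) (y' (ψ n)) = m ∧
        κ ≤ H (a (ψ n) + (2 * β) • x (ψ n)) (x (ψ n)) * g (t (ψ n))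
          - H (b (ψ n) - (2 * β) • y (ψ n)) (y (ψ n)) * g (s (ψ n)) := by
    filter_upwards [lt hI, ls hI, hneev] with n h1 h2 h3
    exact hprop (ψ n) h1 h2 h3
  have hHa : H ab xb = m := tendsto_nhds_unique (lH _ _ _ _ la lx')
    (tendsto_const_nhds.congr' (hev.mono fun n h => h.1.symm))
  have hHb : H bb yb = m := tendsto_nhds_unique (lH _ _ _ _ lb ly')
    (tendsto_const_nhds.congr' (hev.mono fun n h => h.2.1.symm))
  have hfin : κ ≤ H (ab + (2 * β) • xb) xb * g tb - H (bb - (2 * β) • yb) yb * g tb :=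
    ge_of_tendsto (((lH _ _ _ _ (la.add (lx.const_smul (2 * β))) lx).mul
        (lg _ lt fun n => (ht _).1)).sub
      ((lH _ _ _ _ (lb.sub (ly.const_smul (2 * β))) ly).mul (lg _ ls fun n => (hs _).1)))
      (hev.mono fun n h => h.2.2)
  -- conclusion
  have hβb : β * (‖xb‖ ^ 2 + ‖yb‖ ^ 2) ≤ 2 * M :=
    le_of_tendsto (((lx.norm.pow 2).add (ly.norm.pow 2)).const_mul β)
      (Filter.Eventually.of_forall fun n => (hbd (ψ n)).1)
  have hsm : ∀ z : EuclideanSpace ℝ (Fin d), β * ‖z‖ ^ 2 ≤ 2 * M → ‖(2 * β) • z‖ ≤ τ := by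
    intro z hz
    rw [norm_smul, Real.norm_eq_abs, abs_of_pos (by positivity)]
    refine abs_le_of_sq_le_sq' ?_ hτ0.le |>.2
    nlinarith
  have hx1 := hsm xb (by nlinarith [sq_nonneg ‖yb‖])
  have hy1 := hsm yb (by nlinarith [sq_nonneg ‖xb‖])
  have e1 := hΛ xb ab ((2 * β) • xb) hab (hx1.trans hτ1)
  have e2 := hΛ yb bb (-((2 * β) • yb)) hbb (by rw [norm_neg]; exact hy1.trans hτ1)
  rw [← sub_eq_add_neg, norm_neg, hHb] at e2
  rw [hHa] at e1
  have e3 := e1.trans (mul_le_mul_of_nonneg_left hx1 hΛ0)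
  have e4 := e2.trans (mul_le_mul_of_nonneg_left hy1 hΛ0)
  have hgG : |g tb| ≤ G := hG tb htb
  set A := H (ab + (2 * β) • xb) xb
  set B := H (bb - (2 * β) • yb) yb
  have e5 : |A - B| ≤ 2 * (Λ * τ) := by
    rw [abs_le] at e3 e4 ⊢
    constructor <;> linarith
  have e6 : A * g tb - B * g tb ≤ 2 * (Λ * τ) * G := by
    calc A * g tb - B * g tb = (A - B) * g tb := by ring
      _ ≤ |A - B| * |g tb| := by rw [← abs_mul]; exact le_abs_self _
      _ ≤ 2 * (Λ * τ) * G := by gcongr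
  linarith

end main

/-- preservation of Lipschitz bounds for pathwise viscosity
solutions: if `ν̲(s) → ∞`, `u₀` is bounded and `L`-Lipschitz and `u` solves
`u_t = H(Du,x)ζ'(t)` with `u(·,0) = u₀`, then for all `t ≥ 0`,
`|u(x,t) − u(y,t)| ≤ ν̲^{-1}(ν̄(L))·|x−y|`, where
`ν̲^{-1}(m) = sup{s ≥ 0 : ν̲(s) ≤ m}`. -/
theorem lipschitz_estimate_pathwise (d : ℕ) (hd : 1 ≤ d)
    (H : EuclideanSpace ℝ (Fin d) → EuclideanSpace ℝ (Fin d) → ℝ)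
    (νlo νhi : ℝ → ℝ)
    (hA1 : AssumptionA1 d H νlo νhi) (hA2 : AssumptionA2 d H)
    (hcoercive : Filter.Tendsto νlo Filter.atTop Filter.atTop)
    (ζ : ℝ → ℝ) (hζ : ContDiffOn ℝ 1 ζ (Ici (0 : ℝ)))
    (L : ℝ) (hL : 0 ≤ L)
    (u₀ : EuclideanSpace ℝ (Fin d) → ℝ)
    (hu₀bdd : ∃ M, ∀ x, |u₀ x| ≤ M)
    (hu₀lip : LipschitzWith (Real.toNNReal L) u₀)
    (u : EuclideanSpace ℝ (Fin d) → ℝ → ℝ)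
    (hucont : ContinuousOn (fun q : EuclideanSpace ℝ (Fin d) × ℝ => u q.1 q.2)
      (univ ×ˢ Ici (0 : ℝ)))
    (hubdd : ∀ T > (0 : ℝ), ∃ M, ∀ x, ∀ t ∈ Icc (0 : ℝ) T, |u x t| ≤ M)
    (huinit : ∀ x, u x 0 = u₀ x)
    (husol : ViscositySolution d H (fun t => derivWithin ζ (Ici (0 : ℝ)) t) u) :
    ∀ t ≥ (0 : ℝ), ∀ x y,
      |u x t - u y t| ≤ sSup {s : ℝ | 0 ≤ s ∧ νlo s ≤ νhi L} * ‖x - y‖ := by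
  obtain ⟨hH, hconv, -, -, hmlo, hmhi, hbd⟩ := hA1
  set m := νhi L with hm
  set K := sSup {s : ℝ | 0 ≤ s ∧ νlo s ≤ m} with hKdef
  have hbdd : BddAbove {s : ℝ | 0 ≤ s ∧ νlo s ≤ m} := by
    obtain ⟨b, hb⟩ := (hcoercive.eventually_gt_atTop m).exists_forall_of_atTop
    refine ⟨b, fun s hs => ?_⟩
    by_contra hlt
    have := hb s (not_le.1 hlt).le
    linarith [hs.2]
  have hK : ∀ a z, H a z ≤ m → ‖a‖ ≤ K := fun a z h =>
    le_csSup hbdd ⟨norm_nonneg a, (hbd a z).1.trans h⟩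
  have hLm : ∀ a z, ‖a‖ ≤ L → H a z ≤ m := fun a z h =>
    (hbd a z).2.trans (hmhi (norm_nonneg a) hL h)
  have h0 : ∀ z, H 0 z ≤ m := fun z => hLm 0 z (by simpa using hL)
  have hKn : 0 ≤ K := by simpa using hK 0 0 (h0 0)
  have hB : ∀ x p q, ‖p‖ ≤ K + 2 → ‖q‖ ≤ K + 2 → H p x - H q x ≤ νhi (K + 2) - νlo 0 := by
    intro x p q hp _
    have h1 := (hbd p x).2.trans (hmhi (norm_nonneg p) (show (0 : ℝ) ≤ K + 2 by linarith) hp)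
    have h2 := (hmlo (show (0 : ℝ) ≤ 0 from le_rfl) (norm_nonneg q) (norm_nonneg q)).trans (hbd q x).1
    linarith
  have hinit : ∀ x y, u x 0 - u y 0 ≤ dm H m x y := by
    intro x y
    rw [huinit, huinit]
    refine le_dm hK (adm_of_lip hL hLm fun x y => ?_) x y
    have := hu₀lip.dist_le_mul x y
    rw [Real.dist_eq, dist_eq_norm, Real.coe_toNNReal L hL] at this
    exact (le_abs_self _).trans this
  have hg : ContinuousOn (fun t => derivWithin ζ (Ici (0 : ℝ)) t) (Ici 0) :=
    hζ.continuousOn_derivWithin (uniqueDiffOn_Ici 0) le_rfl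
  have main : ∀ t ≥ (0 : ℝ), ∀ x y, u x t - u y t ≤ K * ‖x - y‖ := by
    intro t ht x y
    refine le_trans ?_ (dm_le_norm hK h0 x y)
    rcases ht.eq_or_lt with h | h
    · rw [← h]; exact hinit x y
    · refine comparison husol hg hucont hubdd hH hconv hK h0 (Λ := νhi (K + 2) - νlo 0) ?_ ?_ hinit h x y
      · have := hB 0 0 0 (by simp; linarith) (by simp; linarith)
        simpa using this
      · intro x a h ha hh
        exact conv_lip (hconv x) (hB x) ha hh
  intro t ht x y
  rw [abs_le]
  have h1 := main t ht x y
  have h2 := main t ht y x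
  rw [norm_sub_rev] at h2
  constructor <;> linarith

end
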